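/- The function g(x) = exp(H(x))·log(H(x))/x is (strictly) increasing on the interval [4, ∞). -/

import Mathlib

open Real

/-- The continuous interpolation `H(x) = ∫₀¹ (tˣ − 1)/(t − 1) dt` of the
harmonic numbers. -/
noncomputable def harmonicInterp (x : ℝ) : ℝ :=
  ∫ t in (0 : ℝ)..1, (t ^ x - 1) / (t - 1)

theorem intervalIntegrable_rpow_sub_one_div {x : ℝ} (hx : 1 ≤ x) :
    IntervalIntegrable (fun t : ℝ => (t ^ x - 1) / (t - 1)) MeasureTheory.volume 0 1 := by
  refine (intervalIntegrable_const (c := x)).mono_fun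
    (by fun_prop : Measurable fun t : ℝ => (t ^ x - 1) / (t - 1)).aestronglyMeasurable ?_
  refine (MeasureTheory.ae_restrict_iff' measurableSet_uIoc).2 (.of_forall fun t ht => ?_)
  rw [Set.uIoc_of_le zero_le_one] at ht
  obtain ⟨h0, h1⟩ := ht
  dsimp only
  rw [norm_eq_abs, norm_eq_abs, abs_of_nonneg (by linarith : 0 ≤ x)]
  rcases h1.eq_or_lt with rfl | h1
  · simp; linarith
  have hb := one_add_mul_self_le_rpow_one_add (s := t - 1) (by linarith) hx
  rw [add_sub_cancel] at hb
  have hle : t ^ x ≤ 1 := rpow_le_one h0.le h1.le (by linarith)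
  rw [← neg_div_neg_eq, abs_of_nonneg (div_nonneg (by linarith) (by linarith)),
    div_le_iff₀ (by linarith)]
  nlinarith

theorem one_le_log_div_sub_one {t : ℝ} (h0 : 0 < t) (h1 : t < 1) :
    1 ≤ log t / (t - 1) := by
  rw [← neg_div_neg_eq, le_div_iff₀ (by linarith)]
  linarith [log_le_sub_one_of_pos h0]

theorem log_div_sub_one_le_inv {t : ℝ} (h0 : 0 < t) (h1 : t < 1) :
    log t / (t - 1) ≤ t⁻¹ := by
  rw [← neg_div_neg_eq, div_le_iff₀ (by linarith)]
  have h := one_sub_inv_le_log_of_pos h0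
  have : t⁻¹ * -(t - 1) = t⁻¹ - 1 := by field_simp; ring
  linarith

theorem rpow_mul_log_div_nonneg {t : ℝ} (x : ℝ) (h0 : 0 < t) (h1 : t ≤ 1) :
    0 ≤ t ^ x * log t / (t - 1) :=
  div_nonneg_of_nonpos
    (mul_nonpos_of_nonneg_of_nonpos (rpow_nonneg h0.le x) (log_nonpos h0.le h1)) (by linarith)

theorem rpow_mul_log_div_le {t : ℝ} (x : ℝ) (h0 : 0 < t) (h1 : t ≤ 1) :
    t ^ x * log t / (t - 1) ≤ t ^ (x - 1) := by
  rcases h1.eq_or_lt with rfl | h1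
  · simp
  rw [rpow_sub_one h0.ne', mul_div_assoc, div_eq_mul_inv]
  exact mul_le_mul_of_nonneg_left (log_div_sub_one_le_inv h0 h1) (rpow_nonneg h0.le x)

theorem hasDerivAt_harmonicInterp {x : ℝ} (hx : 1 < x) :
    IntervalIntegrable (fun t : ℝ => t ^ x * log t / (t - 1)) MeasureTheory.volume 0 1 ∧
      HasDerivAt harmonicInterp (∫ t in (0 : ℝ)..1, t ^ x * log t / (t - 1)) x := by
  refine intervalIntegral.hasDerivAt_integral_of_dominated_loc_of_deriv_le
    (F := fun x t : ℝ => (t ^ x - 1) / (t - 1))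
    (F' := fun x t : ℝ => t ^ x * log t / (t - 1)) (bound := fun _ => 1)
    (Ioi_mem_nhds hx) (.of_forall fun y => Measurable.aestronglyMeasurable (by fun_prop))
    (intervalIntegrable_rpow_sub_one_div hx.le)
    (Measurable.aestronglyMeasurable (by fun_prop))
    (.of_forall fun t ht y hy => ?_) intervalIntegrable_const
    (.of_forall fun t ht y hy => ?_)
  · rw [Set.uIoc_of_le zero_le_one] at ht
    rw [norm_eq_abs, abs_of_nonneg (rpow_mul_log_div_nonneg y ht.1 ht.2)]
    exact (rpow_mul_log_div_le y ht.1 ht.2).trans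
      (rpow_le_one ht.1.le ht.2 (by linarith [Set.mem_Ioi.1 hy]))
  · rw [Set.uIoc_of_le zero_le_one] at ht
    exact (((hasStrictDerivAt_const_rpow ht.1 y).hasDerivAt).sub_const 1).div_const _

theorem inv_add_one_le_deriv_harmonicInterp {x : ℝ} (hx : 1 < x) :
    (x + 1)⁻¹ ≤ deriv harmonicInterp x := by
  obtain ⟨hi, hd⟩ := hasDerivAt_harmonicInterp hx
  have h : ∫ t in (0 : ℝ)..1, t ^ x = (x + 1)⁻¹ := by
    rw [integral_rpow (Or.inl (by linarith)), one_rpow, zero_rpow (by linarith)]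
    simp
  rw [hd.deriv, ← h]
  refine intervalIntegral.integral_mono_on_of_le_Ioo zero_le_one
    (intervalIntegral.intervalIntegrable_rpow' (by linarith)) hi fun t ht => ?_
  rw [mul_div_assoc]
  exact le_mul_of_one_le_right (rpow_nonneg ht.1.le x) (one_le_log_div_sub_one ht.1 ht.2)

theorem deriv_harmonicInterp_le_inv {x : ℝ} (hx : 1 < x) :
    deriv harmonicInterp x ≤ x⁻¹ := by
  obtain ⟨hi, hd⟩ := hasDerivAt_harmonicInterp hx
  have h : ∫ t in (0 : ℝ)..1, t ^ (x - 1) = x⁻¹ := by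
    rw [integral_rpow (Or.inl (by linarith)), sub_add_cancel, one_rpow, zero_rpow (by linarith)]
    simp
  rw [hd.deriv, ← h]
  exact intervalIntegral.integral_mono_on_of_le_Ioo zero_le_one hi
    (intervalIntegral.intervalIntegrable_rpow' (by linarith))
    fun t ht => rpow_mul_log_div_le x ht.1 ht.2.le

theorem differentiableAt_harmonicInterp {x : ℝ} (hx : 1 < x) :
    DifferentiableAt ℝ harmonicInterp x :=
  (hasDerivAt_harmonicInterp hx).2.differentiableAt

theorem harmonicInterp_two : harmonicInterp 2 = 3 / 2 := by
  have h : harmonicInterp 2 = ∫ t in (0 : ℝ)..1, (t + 1) := by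
    refine intervalIntegral.integral_congr_Ioo_of_le zero_le_one fun t ht => ?_
    have : t - 1 ≠ 0 := by linarith [ht.2]
    simp only [rpow_two]
    field_simp
    ring
  rw [h, intervalIntegral.integral_add (by simp) (by simp)]
  norm_num

theorem three_halves_le_harmonicInterp {x : ℝ} (hx : 2 ≤ x) : 3 / 2 ≤ harmonicInterp x := by
  rw [← harmonicInterp_two]
  refine monotoneOn_of_deriv_nonneg (convex_Ici 2)
    (fun y hy => (differentiableAt_harmonicInterp
      (by linarith [Set.mem_Ici.1 hy])).continuousAt.continuousWithinAt)
    (fun y hy => ?_) (fun y hy => ?_) Set.self_mem_Ici hx hx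
  all_goals rw [interior_Ici, Set.mem_Ioi] at hy
  · exact (differentiableAt_harmonicInterp (by linarith)).differentiableWithinAt
  · exact le_trans (by positivity) (inv_add_one_le_deriv_harmonicInterp (by linarith))

theorem harmonicInterp_le_one_add_log {x : ℝ} (hx : 2 ≤ x) :
    harmonicInterp x ≤ 1 + log x := by
  have hda : ∀ y : ℝ, 2 ≤ y → HasDerivAt (fun y => log y - harmonicInterp y)
      (y⁻¹ - deriv harmonicInterp y) y := fun y hy =>
    (hasDerivAt_log (by linarith)).sub (differentiableAt_harmonicInterp (by linarith)).hasDerivAt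
  have hm : log 2 - harmonicInterp 2 ≤ log x - harmonicInterp x := by
    refine monotoneOn_of_deriv_nonneg (convex_Ici 2)
      (fun y hy => (hda y hy).continuousAt.continuousWithinAt)
      (fun y hy => ?_) (fun y hy => ?_) Set.self_mem_Ici hx hx
    all_goals rw [interior_Ici, Set.mem_Ioi] at hy
    · exact (hda y hy.le).differentiableAt.differentiableWithinAt
    · rw [(hda y hy.le).deriv]
      exact sub_nonneg.2 (deriv_harmonicInterp_le_inv (by linarith))
  rw [harmonicInterp_two] at hm
  linarith [log_two_gt_d9]

theorem add_sq_lt_exp {u : ℝ} (hu : 0 ≤ u) : u + u ^ 2 < exp u := by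
  have h := sum_le_exp_of_nonneg hu 5
  simp only [Finset.sum_range_succ, Finset.sum_range_zero, Nat.factorial] at h
  norm_num at h
  nlinarith [sq_nonneg (u ^ 2 + 2 * u - 6), mul_nonneg hu (sq_nonneg (u - 2)), sq_nonneg (u - 3 / 2),
    sq_nonneg (u ^ 2 - 2)]

theorem harmonicInterp_mul_log_lt {x : ℝ} (hx : 2 ≤ x) :
    harmonicInterp x * log (harmonicInterp x) < x := by
  have h1 := three_halves_le_harmonicInterp hx
  have h2 := harmonicInterp_le_one_add_log hx
  have h3 := log_le_sub_one_of_pos (by linarith : 0 < harmonicInterp x)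
  have hL : 0 ≤ log x := log_nonneg (by linarith)
  have h4 := add_sq_lt_exp hL
  rw [exp_log (by linarith)] at h4
  calc harmonicInterp x * log (harmonicInterp x)
      ≤ (1 + log x) * log x :=
        mul_le_mul h2 (by linarith) (log_nonneg (by linarith)) (by linarith)
    _ < x := by linarith

/-- The function `g(x) = exp(H(x))·log(H(x))/x` is strictly increasing on
`[4, ∞)`. -/
theorem strictMonoOn_exp_harmonicInterp_mul_log_div :
    StrictMonoOn
      (fun x : ℝ => Real.exp (harmonicInterp x) * Real.log (harmonicInterp x) / x)
      (Set.Ici 4) := by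
  have hda : ∀ x : ℝ, 4 ≤ x → HasDerivAt
      (fun x : ℝ => exp (harmonicInterp x) * log (harmonicInterp x) / x)
      ((((exp (harmonicInterp x) * deriv harmonicInterp x) * log (harmonicInterp x)
        + exp (harmonicInterp x) * (deriv harmonicInterp x / harmonicInterp x)) * x
        - exp (harmonicInterp x) * log (harmonicInterp x) * 1) / x ^ 2) x := fun x hx => by
    have hd := (differentiableAt_harmonicInterp (by linarith : 1 < x)).hasDerivAt
    have hH := three_halves_le_harmonicInterp (by linarith : 2 ≤ x)
    exact (hd.exp.mul (hd.log (by linarith))).div (hasDerivAt_id x) (by simp; linarith)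
  refine strictMonoOn_of_deriv_pos (convex_Ici 4)
    (fun x hx => (hda x hx).continuousAt.continuousWithinAt) fun x hx => ?_
  rw [interior_Ici, Set.mem_Ioi] at hx
  rw [(hda x hx.le).deriv]
  have hlt := harmonicInterp_mul_log_lt (by linarith : 2 ≤ x)
  have hD := inv_add_one_le_deriv_harmonicInterp (by linarith : 1 < x)
  have hH := three_halves_le_harmonicInterp (by linarith : 2 ≤ x)
  set h := harmonicInterp x
  set d := deriv harmonicInterp x
  have hl : 0 < log h := log_pos (by linarith)
  have hx0 : 0 < x := by linarith
  have hh : 0 < h := by linarith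
  have key : log h < (x + 1)⁻¹ * ((log h + 1 / h) * x) := by
    rw [inv_mul_eq_div, lt_div_iff₀ (by linarith)]
    have : log h < x / h := (lt_div_iff₀ hh).2 (by linarith)
    have e : (log h + 1 / h) * x = log h * x + x / h := by ring
    linarith
  have hmul : (x + 1)⁻¹ * ((log h + 1 / h) * x) ≤ d * ((log h + 1 / h) * x) := by gcongr
  have e : (exp h * d * log h + exp h * (d / h)) * x - exp h * log h * 1
      = exp h * (d * ((log h + 1 / h) * x) - log h) := by ring
  rw [e]
  exact div_pos (mul_pos (exp_pos h) (by linarith)) (by positivity)
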